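/- arXiv:1605.00316 — 2 statements merged into one kernel-verified Lean document; each statement's English description precedes it below -/
import Mathlib

section
/- Let c > a > 0 and a/c < r < 1. If κ(r) is the (unique) solution of g(a,c;κ) = r, then L(r) < κ(r) < B(r) < U(r), where L(r) = ((rc-a)/(r(1-r)))(1 + (1-r)/(c-a)), B(r) = ((rc-a)/(2r(1-r)))(1 + sqrt(1 + 4(c+1)r(1-r)/(a(c-a)))), and U(r) = ((rc-a)/(r(1-r)))(1 + r/a). -/
/-- The rising factorial `(a)_j = a (a+1) ⋯ (a+j-1)`. -/
noncomputable def risingFac (a : ℝ) : ℕ → ℝ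
  | 0 => 1
  | j + 1 => risingFac a j * (a + j)

/-- Kummer's confluent hypergeometric function
`M(a, c, κ) = Σ_{j ≥ 0} ((a)_j / (c)_j) κ^j / j!`. -/
noncomputable def M (a c κ : ℝ) : ℝ :=
  ∑' j : ℕ, risingFac a j / risingFac c j * κ ^ j / (Nat.factorial j : ℝ)

/-- `g(a, c; κ) = M'(a, c; κ) / M(a, c; κ)`, the derivative taken in `κ`. -/
noncomputable def g (a c κ : ℝ) : ℝ := deriv (M a c) κ / M a c κ

/-- The lower bound `L(r)`. -/
noncomputable def L (a c r : ℝ) : ℝ :=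
  (r * c - a) / (r * (1 - r)) * (1 + (1 - r) / (c - a))

/-- The middle bound `B(r)`. -/
noncomputable def B (a c r : ℝ) : ℝ :=
  (r * c - a) / (2 * r * (1 - r)) *
    (1 + Real.sqrt (1 + 4 * (c + 1) * r * (1 - r) / (a * (c - a))))

/-- The upper bound `U(r)`. -/
noncomputable def U (a c r : ℝ) : ℝ :=
  (r * c - a) / (r * (1 - r)) * (1 + r / a)

/-- exponential generating series -/
noncomputable def egf (α : ℕ → ℝ) (x : ℝ) : ℝ := ∑' j : ℕ, α j * x ^ j / (Nat.factorial j : ℝ)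

lemma egf_summable (α : ℕ → ℝ) (C : ℝ) (h : ∀ j, |α j| ≤ C) (x : ℝ) :
    Summable (fun j : ℕ => α j * x ^ j / (Nat.factorial j : ℝ)) := by
  have h1 : Summable (fun j : ℕ => C * (|x| ^ j / (Nat.factorial j : ℝ))) :=
    (Real.summable_pow_div_factorial |x|).mul_left C
  refine Summable.of_norm_bounded h1 (fun j => ?_)
  rw [Real.norm_eq_abs, abs_div, abs_mul, abs_pow, mul_div_assoc, Nat.abs_cast]
  exact mul_le_mul_of_nonneg_right (h j) (by positivity)

lemma egf_hasDerivAt (α : ℕ → ℝ) (C : ℝ) (h : ∀ j, |α j| ≤ C) (x : ℝ) :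
    HasDerivAt (egf α) (egf (fun j => α (j + 1)) x) x := by
  have hC : 0 ≤ C := (abs_nonneg _).trans (h 0)
  set R := |x| + 1 with hR
  have hR0 : 0 < R := by positivity
  have key := hasDerivAt_tsum_of_isPreconnected (𝕜 := ℝ) (F := ℝ)
    (g := fun (j : ℕ) (y : ℝ) => α j * y ^ j / (Nat.factorial j : ℝ))
    (g' := fun (j : ℕ) (y : ℝ) => α j * (j * y ^ (j - 1)) / (Nat.factorial j : ℝ))
    (u := fun j : ℕ => C * (j * R ^ (j - 1) / (Nat.factorial j : ℝ)))
    (t := Metric.ball (0 : ℝ) R) (y₀ := 0) (y := x)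
    ?_ Metric.isOpen_ball (convex_ball (0 : ℝ) R).isPreconnected ?_ ?_ ?_ ?_ ?_
  · have e : egf (fun j => α (j + 1)) x
        = ∑' j : ℕ, α j * (j * x ^ (j - 1)) / (Nat.factorial j : ℝ) := by
      have hs : Summable (fun j : ℕ => α j * (j * x ^ (j - 1)) / (Nat.factorial j : ℝ)) := by
        rw [← summable_nat_add_iff 1]
        refine (egf_summable (fun j => α (j + 1)) C (fun j => h _) x).congr (fun j => ?_)
        rw [Nat.factorial_succ]; push_cast
        have : (j : ℝ) + 1 ≠ 0 := by positivity
        field_simp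
      rw [hs.tsum_eq_zero_add]
      simp only [egf, Nat.cast_zero, zero_mul, mul_zero, zero_div, zero_add]
      refine tsum_congr (fun j => ?_)
      rw [Nat.factorial_succ]; push_cast
      have : (j : ℝ) + 1 ≠ 0 := by positivity
      field_simp
    rw [e]; exact key
  · refine Summable.mul_left C ?_
    rw [← summable_nat_add_iff 1]
    refine (Real.summable_pow_div_factorial R).congr (fun j => ?_)
    rw [Nat.factorial_succ]; push_cast
    have : (j : ℝ) + 1 ≠ 0 := by positivity
    field_simp
  · intro j y _
    exact ((hasDerivAt_pow j y).const_mul (α j)).div_const _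
  · intro j y hy
    have hy' : |y| ≤ R := by
      have := mem_ball_zero_iff.1 hy
      rw [Real.norm_eq_abs] at this; exact this.le
    rw [Real.norm_eq_abs, abs_div, abs_mul, abs_mul, abs_pow, mul_div_assoc, Nat.abs_cast,
      Nat.abs_cast]
    have := h j
    gcongr
  · simpa using hR0
  · exact egf_summable α C h 0
  · rw [mem_ball_zero_iff, Real.norm_eq_abs, hR]; linarith

lemma egf_theta (α : ℕ → ℝ) (C : ℝ) (h : ∀ j, |α j| ≤ C) (x : ℝ) :
    HasSum (fun j : ℕ => (j * α j) * x ^ j / (Nat.factorial j : ℝ))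
      (x * egf (fun j => α (j + 1)) x) := by
  rw [← hasSum_nat_add_iff' 1]
  simp only [Finset.range_one, Finset.sum_singleton, Nat.cast_zero, zero_mul, zero_div, sub_zero]
  have := (egf_summable (fun j => α (j + 1)) C (fun j => h _) x).hasSum.mul_left x
  refine this.congr_fun ?_ |> id
  intro j
  rw [Nat.factorial_succ]; push_cast
  have : (j : ℝ) + 1 ≠ 0 := by positivity
  rw [pow_succ]
  field_simp

lemma diff_formula (D : ℕ → ℕ → ℝ) (hD : ∀ n j, D (n + 1) j = D n j - D n (j + 1)) :
    ∀ n m, D n m = ∑ k ∈ Finset.range (n + 1), (-1 : ℝ) ^ k * (n.choose k) * D 0 (m + k) := by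
  have e : ∀ n m, (fwdDiff 1)^[n] (D 0) m = (-1 : ℝ) ^ n * D n m := by
    intro n
    induction n with
    | zero => intro m; simp
    | succ n ih =>
      intro m
      rw [Function.iterate_succ_apply', fwdDiff, ih, ih, hD]; ring
  intro n m
  have h1 := e n m
  rw [fwdDiff_iter_eq_sum_shift] at h1
  have h2 : D n m = (-1 : ℝ) ^ n * ((-1 : ℝ) ^ n * D n m) := by
    rw [← mul_assoc, ← mul_pow]; norm_num
  rw [h2, ← h1, Finset.mul_sum]
  refine Finset.sum_congr rfl (fun k hk => ?_)
  have hk' : k ≤ n := by simpa [Nat.lt_succ_iff] using hk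
  obtain ⟨d, rfl⟩ := Nat.exists_eq_add_of_le hk'
  simp only [Nat.add_sub_cancel_left, smul_eq_mul, mul_one, zsmul_eq_mul]
  push_cast
  rw [pow_add]
  have : ((-1 : ℝ) ^ d) * (-1) ^ d = 1 := by rw [← mul_pow]; norm_num
  linear_combination ((-1 : ℝ) ^ k * ((k + d).choose k) * D 0 (m + k)) * this

lemma egf_pos_nonneg (α : ℕ → ℝ) (C : ℝ) (h : ∀ j, |α j| ≤ C) (hp : ∀ j, 0 < α j) (x : ℝ)
    (hx : 0 ≤ x) : 0 < egf α x := by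
  refine (egf_summable α C h x).tsum_pos (fun j => ?_) 0 ?_
  · have := hp j; positivity
  · simpa using hp 0

lemma egf_pos (D : ℕ → ℕ → ℝ) (hD : ∀ n j, D (n + 1) j = D n j - D n (j + 1))
    (hp : ∀ n j, 0 < D n j) (x : ℝ) : 0 < egf (D 0) x := by
  have b1 : ∀ n j, D n j ≤ D 0 j := by
    intro n
    induction n with
    | zero => intro j; exact le_rfl
    | succ n ih => intro j; rw [hD]; linarith [hp n (j + 1), ih j]
  have b2 : ∀ j, D 0 j ≤ D 0 0 := by
    intro j
    induction j with
    | zero => exact le_rfl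
    | succ j ih => linarith [hD 0 j, hp 1 j]
  have b0 : ∀ j, |D 0 j| ≤ D 0 0 := fun j => by rw [abs_of_pos (hp 0 j)]; exact b2 j
  have bn : ∀ n, |D n 0| ≤ D 0 0 := fun n => by rw [abs_of_pos (hp n 0)]; exact b1 n 0
  rcases le_total 0 x with hx | hx
  · exact egf_pos_nonneg _ _ b0 (hp 0) x hx
  · have h1 := egf_pos_nonneg (fun n => D n 0) _ bn (fun n => hp n 0) (-x) (by linarith)
    have s1 := (egf_summable (D 0) _ b0 x).norm
    have s2 := (egf_summable (fun _ => 1) 1 (by simp) (-x)).norm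
    have h2 := tsum_mul_tsum_eq_tsum_sum_antidiagonal_of_summable_norm s1 s2
    have h3 : egf (fun n => D n 0) (-x) = egf (D 0) x * egf (fun _ => 1) (-x) := by
      unfold egf
      rw [h2]
      refine tsum_congr (fun n => ?_)
      beta_reduce
      rw [Finset.Nat.sum_antidiagonal_eq_sum_range_succ_mk, diff_formula D hD n 0,
        Finset.sum_mul, Finset.sum_div]
      refine Finset.sum_congr rfl (fun k hk => ?_)
      have hk' : k ≤ n := by simpa [Nat.lt_succ_iff] using hk
      obtain ⟨d, rfl⟩ := Nat.exists_eq_add_of_le hk'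
      simp only [Nat.add_sub_cancel_left, zero_add]
      rw [Nat.cast_add_choose, neg_pow x, neg_pow x, pow_add, pow_add]
      have : ((-1 : ℝ) ^ k) * (-1) ^ k = 1 := by rw [← mul_pow]; norm_num
      have f1 : ((k + d).factorial : ℝ) ≠ 0 := by positivity
      have f2 : ((k).factorial : ℝ) ≠ 0 := by positivity
      have f3 : ((d).factorial : ℝ) ≠ 0 := by positivity
      field_simp
      linear_combination (D 0 k * x ^ k * x ^ d) * this
    have h4 : 0 < egf (fun _ => 1) (-x) :=
      egf_pos_nonneg _ 1 (by simp) (fun _ => one_pos) _ (by linarith)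
    rw [h3] at h1
    exact (pos_iff_pos_of_mul_pos h1).2 h4

lemma risingFac_pos (a : ℝ) (ha : 0 < a) : ∀ j, 0 < risingFac a j := by
  intro j
  induction j with
  | zero => simp [risingFac]
  | succ j ih => simp only [risingFac]; positivity

/-- barrier -/
lemma barrier (φ : ℝ → ℝ) (k : ℝ) (hk : 0 < k) (hc : ContinuousOn φ (Set.Icc 0 k))
    (h0 : 0 ≤ φ 0)
    (hd : ∀ x, 0 < x → x ≤ k → φ x ≤ 0 → ∃ d, 0 < d ∧ HasDerivAt φ d x) : 0 < φ k := by
  by_contra! hcon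
  obtain ⟨m, hm, hmin⟩ := isCompact_Icc.exists_isMinOn (Set.nonempty_Icc.2 hk.le) hc
  have main : ∀ m, 0 < m → m ≤ k → (∀ y ∈ Set.Icc 0 k, φ m ≤ φ y) → False := by
    intro m hm0 hmk hmin
    obtain ⟨d, hd0, hder⟩ := hd m hm0 hmk ((hmin k ⟨hk.le, le_rfl⟩).trans hcon)
    have h1 := (hasDerivAt_iff_tendsto_slope_left_right.1 hder).1
    have h2 := h1.eventually (lt_mem_nhds hd0)
    have h3 : ∀ᶠ y in nhdsWithin m (Set.Iio m), 0 < y :=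
      nhdsWithin_le_nhds (lt_mem_nhds hm0)
    obtain ⟨y, ⟨hy1, hy2⟩, hy3⟩ := ((h2.and h3).and self_mem_nhdsWithin).exists
    have hy3' : y < m := hy3
    have := hmin y ⟨hy2.le, by linarith⟩
    rw [slope_def_field] at hy1
    have h5 : (φ y - φ m) / (y - m) ≤ 0 := div_nonpos_of_nonneg_of_nonpos (by linarith) (by linarith)
    linarith
  rcases hm.1.eq_or_lt with h | h
  · subst h
    have h1 : φ 0 ≤ φ k := hmin ⟨hk.le, le_rfl⟩
    refine main k hk le_rfl (fun y hy => ?_)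
    have : φ 0 ≤ φ y := hmin hy
    linarith
  · exact main m h hm.2 (fun y hy => hmin hy)

/-- iterated differences of the coefficients -/
noncomputable def DD (a c : ℝ) (n j : ℕ) : ℝ :=
  risingFac (c - a) n * risingFac a j / risingFac c (j + n)

lemma DD_pos (a c : ℝ) (ha : 0 < a) (hac : a < c) (n j : ℕ) : 0 < DD a c n j := by
  have h1 := risingFac_pos (c - a) (by linarith) n
  have h2 := risingFac_pos a ha j
  have h3 := risingFac_pos c (by linarith) (j + n)
  unfold DD; positivity

lemma DD_rec (a c : ℝ) (ha : 0 < a) (hac : a < c) (n j : ℕ) :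
    DD a c (n + 1) j = DD a c n j - DD a c n (j + 1) := by
  have h3 := risingFac_pos c (by linarith) (j + n)
  have h4 : 0 < c + (j + n : ℕ) := by
    have : (0 : ℝ) ≤ (j + n : ℕ) := Nat.cast_nonneg _
    linarith
  unfold DD
  rw [show j + 1 + n = (j + n) + 1 by ring, show j + (n + 1) = (j + n) + 1 by ring]
  simp only [risingFac]
  field_simp
  push_cast
  ring

lemma DD_bound (a c : ℝ) (ha : 0 < a) (hac : a < c) (j : ℕ) : |DD a c 0 j| ≤ 1 := by
  rw [abs_of_pos (DD_pos a c ha hac 0 j)]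
  induction j with
  | zero => simp [DD, risingFac]
  | succ j ih => linarith [DD_rec a c ha hac 0 j, DD_pos a c ha hac 1 j]

lemma M_eq (a c : ℝ) : M a c = egf (DD a c 0) := by
  funext x
  unfold M egf DD
  refine tsum_congr (fun j => ?_)
  simp [risingFac]

lemma core (a c : ℝ) (ha : 0 < a) (hac : a < c) : ∃ V W : ℝ → ℝ, ∀ x,
    HasDerivAt (M a c) (V x) x ∧ HasDerivAt V (W x) x ∧ 0 < M a c x ∧ 0 < V x ∧
    0 < M a c x - V x ∧ 0 < V x - W x ∧ x * (V x - W x) = c * V x - a * M a c x := by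
  have hb := DD_bound a c ha hac
  have hr := DD_rec a c ha hac
  have hp := DD_pos a c ha hac
  refine ⟨egf (fun j => DD a c 0 (j + 1)), egf (fun j => DD a c 0 (j + 1 + 1)), fun x => ?_⟩
  have s0 := egf_summable _ 1 hb x
  have s1 := egf_summable (fun j => DD a c 0 (j + 1)) 1 (fun j => hb _) x
  have s2 := egf_summable (fun j => DD a c 0 (j + 1 + 1)) 1 (fun j => hb _) x
  rw [M_eq]
  refine ⟨egf_hasDerivAt _ 1 hb x, egf_hasDerivAt (fun j => DD a c 0 (j + 1)) 1 (fun j => hb _) x,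
    egf_pos _ hr hp x, egf_pos (fun n j => DD a c n (j + 1)) (fun n j => hr n (j + 1))
      (fun n j => hp _ _) x, ?_, ?_, ?_⟩
  · have h := egf_pos (fun n j => DD a c (n + 1) j) (fun n j => hr (n + 1) j)
      (fun n j => hp _ _) x
    have e : egf (DD a c 0) x - egf (fun j => DD a c 0 (j + 1)) x
        = egf (fun j => DD a c (0 + 1) j) x := by
      unfold egf
      rw [← s0.tsum_sub s1]
      refine tsum_congr (fun j => ?_)
      beta_reduce; rw [hr 0 j]; ring
    rw [e]; exact h
  · have h := egf_pos (fun n j => DD a c (n + 1) (j + 1)) (fun n j => hr (n + 1) (j + 1))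
      (fun n j => hp _ _) x
    have e : egf (fun j => DD a c 0 (j + 1)) x - egf (fun j => DD a c 0 (j + 1 + 1)) x
        = egf (fun j => DD a c (0 + 1) (j + 1)) x := by
      unfold egf
      rw [← s1.tsum_sub s2]
      refine tsum_congr (fun j => ?_)
      beta_reduce; rw [hr 0 (j + 1)]; ring
    rw [e]; exact h
  · have t0 := egf_theta _ 1 hb x
    have t1 := egf_theta (fun j => DD a c 0 (j + 1)) 1 (fun j => hb _) x
    have l := (t0.sub t1)
    have r := (s1.hasSum.mul_left c).sub (s0.hasSum.mul_left a)
    have : x * egf (fun j => DD a c 0 (j + 1)) x - x * egf (fun j => DD a c 0 (j + 1 + 1)) x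
      = c * egf (fun j => DD a c 0 (j + 1)) x - a * egf (DD a c 0) x := by
      refine l.unique ?_
      unfold egf
      convert r using 1
      funext j
      have h3 := risingFac_pos c (by linarith) j
      have h4 : 0 < c + (j : ℝ) := by
        have : (0 : ℝ) ≤ (j : ℝ) := Nat.cast_nonneg _
        linarith
      have hrel : DD a c 0 (j + 1) * (c + j) = DD a c 0 j * (a + j) := by
        simp only [DD, risingFac, add_zero]
        field_simp
      linear_combination (-(x ^ j / (j.factorial : ℝ))) * hrel
    linarith

lemma g_facts (a c : ℝ) (ha : 0 < a) (hac : a < c) (x : ℝ) :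
    0 < g a c x ∧ g a c x < 1 ∧ (0 < x → a < g a c x * c) ∧ (x ≤ 0 → g a c x * c ≤ a) ∧
    ∃ d, HasDerivAt (g a c) d x ∧ x * d = a - c * g a c x + x * (g a c x * (1 - g a c x)) := by
  obtain ⟨V, W, h⟩ := core a c ha hac
  have hg : g a c = fun y => V y / M a c y := by
    funext y; unfold g; rw [(h y).1.deriv]
  obtain ⟨h1, h2, h3, h4, h5, h6, h7⟩ := h x
  have hd := h2.div h1 h3.ne'
  refine ⟨?_, ?_, fun hx => ?_, fun hx => ?_, _, by rw [hg]; exact hd, ?_⟩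
  · rw [hg]; positivity
  · rw [hg]; simp only; rw [div_lt_one h3]; linarith
  · rw [hg]; simp only; rw [div_mul_eq_mul_div, lt_div_iff₀ h3]; nlinarith [mul_pos hx h6]
  · rw [hg]; simp only; rw [div_mul_eq_mul_div, div_le_iff₀ h3]; nlinarith [mul_nonneg (neg_nonneg.2 hx) h6.le]
  · rw [hg]; simp only
    field_simp
    linear_combination (-M a c x) * h7

lemma barrier_g (a c k : ℝ) (ha : 0 < a) (hac : a < c) (hk : 0 < k) :
    Set.MapsTo (g a c) (Set.Icc 0 k) (Set.Ioo 0 1) ∧ ContinuousOn (g a c) (Set.Icc 0 k) ∧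
    g a c 0 = a / c := by
  refine ⟨fun x _ => ⟨(g_facts a c ha hac x).1, (g_facts a c ha hac x).2.1⟩, fun x _ => ?_, ?_⟩
  · obtain ⟨d, hd, _⟩ := (g_facts a c ha hac x).2.2.2.2
    exact hd.continuousAt.continuousWithinAt
  · obtain ⟨d, hd, h⟩ := (g_facts a c ha hac 0).2.2.2.2
    have hc : c ≠ 0 := by linarith
    field_simp
    linarith

lemma L_facts (a c r : ℝ) (ha : 0 < a) (hac : a < c) (hr1 : a < r * c) (hr0 : 0 < r)
    (hr2 : r < 1) : 0 < L a c r ∧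
    ∃ d, HasDerivAt (L a c) d r ∧ 0 < d ∧ d * (r * (1 - r) - (r * c - a) / L a c r) < 1 := by
  have hs : 0 < c - a := by linarith
  have h1r : 0 < 1 - r := by linarith
  have hx : 0 < r * c - a := by linarith
  refine ⟨by unfold L; positivity,
    (c - a) / (1 - r) ^ 2 + a / r ^ 2 + a / (r ^ 2 * (c - a)), ?_, by positivity, ?_⟩
  · have e : (L a c) =ᶠ[nhds r] fun y => (c - a) / (1 - y) - a / y + c / (c - a) - a / (y * (c - a)) := by
      filter_upwards [Ioo_mem_nhds hr0 hr2] with y hy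
      have : 0 < y := hy.1
      have : 0 < 1 - y := by linarith [hy.2]
      unfold L; field_simp; ring
    refine HasDerivAt.congr_of_eventuallyEq ?_ e
    have i := hasDerivAt_id' r
    have A := (((hasDerivAt_const r (c - a)).div (i.const_sub 1) h1r.ne').sub
      ((hasDerivAt_const r a).div i hr0.ne')).add_const (c / (c - a))
    have B := A.sub ((hasDerivAt_const r a).div (i.mul_const (c - a)) (by positivity))
    refine B.congr_deriv ?_
    field_simp
    ring
  · have : (r * c - a) / L a c r = r * (1 - r) * (c - a) / (c - a + 1 - r) := by
      have h3 : 0 < c - a + 1 - r := by linarith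
      unfold L; field_simp; ring
    rw [this]
    have h3 : 0 < c - a + 1 - r := by linarith
    have e : 1 - ((c - a) / (1 - r) ^ 2 + a / r ^ 2 + a / (r ^ 2 * (c - a))) *
        (r * (1 - r) - r * (1 - r) * (c - a) / (c - a + 1 - r)) =
        (r * c - a) * (1 - r) * (c - a + 1) / (r * (c - a) * (c - a + 1 - r)) := by
      field_simp
      ring
    have : 0 < (r * c - a) * (1 - r) * (c - a + 1) / (r * (c - a) * (c - a + 1 - r)) := by
      positivity
    linarith

lemma alg_aux (S q x l t w y : ℝ) (hq : q ≠ 0) (hw : w ≠ 0) (hy : y ≠ 0) :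
    (S / q ^ 2 * y + x / q * (l * t / w)) * (q * (y - 1) / y) - 1 =
      ((S * w * (y * (y - 1)) / q + x * l * t * (y - 1)) - y * w) / (y * w) := by
  field_simp

set_option maxHeartbeats 1000000 in
lemma B_facts (a c r : ℝ) (ha : 0 < a) (hac : a < c) (hr1 : a < r * c) (hr0 : 0 < r)
    (hr2 : r < 1) : 0 < B a c r ∧
    ∃ d, HasDerivAt (B a c) d r ∧ 0 < d ∧ 1 < d * (r * (1 - r) - (r * c - a) / B a c r) := by
  have hs : 0 < c - a := by linarith
  have h1r : 0 < 1 - r := by linarith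
  have hx : 0 < r * c - a := by linarith
  have hc : 0 < c := by linarith
  obtain ⟨s, hsd⟩ : ∃ s, s = c - a := ⟨_, rfl⟩
  rw [← hsd] at hs
  obtain ⟨l, hl⟩ : ∃ l, l = (c + 1) / (a * s) := ⟨_, rfl⟩
  have hl0 : 0 < l := by rw [hl]; positivity
  obtain ⟨R, hR⟩ : ∃ R, R = Real.sqrt (1 + 4 * (c + 1) * r * (1 - r) / (a * s)) := ⟨_, rfl⟩
  have harg : 0 < 1 + 4 * (c + 1) * r * (1 - r) / (a * s) := by positivity
  have hR2 : R ^ 2 = 1 + 4 * (c + 1) * r * (1 - r) / (a * s) := by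
    rw [hR, Real.sq_sqrt harg.le]
  have hR0 : 0 < R := by rw [hR]; exact Real.sqrt_pos.2 harg
  obtain ⟨y, hy⟩ : ∃ y, y = (1 + R) / 2 := ⟨_, rfl⟩
  have hRy : R = 2 * y - 1 := by linarith
  have hyq : y ^ 2 - y = l * (r * (1 - r)) := by
    have : R ^ 2 = 1 + 4 * (l * (r * (1 - r))) := by rw [hR2, hl]; field_simp
    rw [hRy] at this; linarith
  have hy0 : 1 / 2 < y := by linarith
  have hq : 0 < r * (1 - r) := by positivity
  have hy1 : 1 < y := by nlinarith [mul_pos hl0 hq]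
  have hBy : B a c r = (r * c - a) / (r * (1 - r)) * y := by
    unfold B; rw [← hsd, ← hR, hRy]; field_simp; ring
  have hder : HasDerivAt (B a c) ((s / (1 - r) ^ 2 + a / r ^ 2) * y +
      (r * c - a) / (r * (1 - r)) * (l * (1 - 2 * r) / (2 * y - 1))) r := by
    have e : (B a c) =ᶠ[nhds r] fun z => (s / (1 - z) - a / z) *
        ((1 + Real.sqrt (1 + 4 * (c + 1) * z * (1 - z) / (a * s))) / 2) := by
      filter_upwards [Ioo_mem_nhds hr0 hr2] with z hz
      have : 0 < z := hz.1
      have : 0 < 1 - z := by linarith [hz.2]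
      unfold B; rw [← hsd]
      have : (z * c - a) / (2 * z * (1 - z)) = (s / (1 - z) - a / z) / 2 := by
        rw [hsd]; field_simp; ring
      rw [this]; ring
    refine HasDerivAt.congr_of_eventuallyEq ?_ e
    have i := hasDerivAt_id' r
    have A := (((hasDerivAt_const r s).div (i.const_sub 1) h1r.ne').sub
      ((hasDerivAt_const r a).div i hr0.ne'))
    have P := ((((i.const_mul (4 * (c + 1))).mul (i.const_sub 1)).div_const (a * s)).const_add 1)
    have Q := ((P.sqrt harg.ne').const_add 1).div_const 2
    have T := A.mul Q
    refine T.congr_deriv ?_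
    try simp only [Pi.div_apply, Pi.sub_apply, Pi.mul_apply]
    rw [← hR, hRy, hl]
    have h2y : 0 < 2 * y - 1 := by linarith
    have : (1 + (2 * y - 1)) / 2 = y := by ring
    rw [this, hsd]
    have : 0 < c - a := by linarith
    field_simp
    ring
  have hBpos : 0 < B a c r := by rw [hBy]; positivity
  -- main inequality
  have hG : r * (1 - r) - (r * c - a) / B a c r = r * (1 - r) * (y - 1) / y := by
    rw [hBy]; field_simp
  have hGpos : 0 < r * (1 - r) * (y - 1) / y := by
    have : 0 < y - 1 := by linarith
    positivity
  have hlas : l * (a * s) = c + 1 := by rw [hl]; field_simp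
  -- y < Z
  have hZ : (c + 2) * y < l * (a + (s - a) * r + a * s) := by
    obtain ⟨Z, hZd⟩ : ∃ Z, Z = l * (a + (s - a) * r + a * s) / (c + 2) := ⟨_, rfl⟩
    have hZe : Z * (c + 2) = l * (a + (s - a) * r + a * s) := by rw [hZd]; field_simp
    have hZ0 : 0 < Z := by
      have : 0 < a + (s - a) * r + a * s := by nlinarith [mul_pos ha h1r, mul_pos hs hr0, mul_pos ha hs]
      rw [hZd]; positivity
    have hZ2 : Z = (c + 1) / c + l * (s - a) / (c * (c + 2)) * (r * c - a) := by
      have : c ≠ 0 := hc.ne'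
      have : c + 2 ≠ 0 := by positivity
      rw [hZd, hl, hsd]
      have : c - a ≠ 0 := by linarith
      field_simp
      ring
    have hZq : Z ^ 2 - Z - l * (r * (1 - r)) =
        ((l * (s - a) / (c * (c + 2))) ^ 2 + l / c ^ 2) * (r * c - a) ^ 2 := by
      have : c ≠ 0 := hc.ne'
      have : c + 2 ≠ 0 := by positivity
      rw [hZ2, hl, hsd]
      have : c - a ≠ 0 := by linarith
      field_simp
      ring
    have : 0 < Z ^ 2 - Z - l * (r * (1 - r)) := by
      rw [hZq]; positivity
    have hyZ : y < Z := by
      by_contra! hcon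
      have h9 : 0 ≤ (y - Z) * (y + Z - 1) := mul_nonneg (by linarith) (by linarith)
      have h10 : (y - Z) * (y + Z - 1) = (y ^ 2 - y) - (Z ^ 2 - Z) := by ring
      linarith
    rw [← hZe, mul_comm (c + 2) y]
    exact mul_lt_mul_of_pos_right hyZ (by linarith)
  have hfin : 1 < ((s / (1 - r) ^ 2 + a / r ^ 2) * y +
      (r * c - a) / (r * (1 - r)) * (l * (1 - 2 * r) / (2 * y - 1))) *
      (r * (1 - r) * (y - 1) / y) := by
    have h2y : 0 < 2 * y - 1 := by linarith
    have e : ((s / (1 - r) ^ 2 + a / r ^ 2) * y +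
      (r * c - a) / (r * (1 - r)) * (l * (1 - 2 * r) / (2 * y - 1))) *
      (r * (1 - r) * (y - 1) / y) - 1 =
      (((s * r ^ 2 + a * (1 - r) ^ 2) * (2 * y - 1) * (y * (y - 1)) / (r * (1 - r))
        + (r * c - a) * l * (1 - 2 * r) * (y - 1)) - y * (2 * y - 1)) / (y * (2 * y - 1)) := by
      have hS : s / (1 - r) ^ 2 + a / r ^ 2 =
          (s * r ^ 2 + a * (1 - r) ^ 2) / (r * (1 - r)) ^ 2 := by field_simp
      rw [hS]
      exact alg_aux _ _ _ _ _ _ _ hq.ne' h2y.ne' (by linarith)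
    have e2 : (s * r ^ 2 + a * (1 - r) ^ 2) * (2 * y - 1) * (y * (y - 1)) / (r * (1 - r))
        = (s * r ^ 2 + a * (1 - r) ^ 2) * (2 * y - 1) * l := by
      have : y * (y - 1) = l * (r * (1 - r)) := by linarith
      rw [this]; field_simp
    have e3 : (s * r ^ 2 + a * (1 - r) ^ 2) * (2 * y - 1) * l
        + (r * c - a) * l * (1 - 2 * r) * (y - 1) - y * (2 * y - 1)
        = y * (l * (a + (s - a) * r + a * s) - (c + 2) * y) := by
      have hca : c = s + a := by linarith
      rw [hca] at hlas ⊢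
      linear_combination (s + a) * hyq - y * hlas
    have : 0 < y * (l * (a + (s - a) * r + a * s) - (c + 2) * y) :=
      mul_pos (by linarith) (by linarith)
    rw [e2, e3] at e
    have : 0 < y * (l * (a + (s - a) * r + a * s) - (c + 2) * y) / (y * (2 * y - 1)) := by
      positivity
    linarith
  refine ⟨hBpos, _, hder, ?_, by rw [hG]; exact hfin⟩
  by_contra! hcon
  have := mul_nonpos_of_nonpos_of_nonneg hcon hGpos.le
  linarith

lemma B_lt_U (a c r : ℝ) (ha : 0 < a) (hac : a < c) (hr1 : a < r * c) (hr0 : 0 < r)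
    (hr2 : r < 1) : B a c r < U a c r := by
  have hs : 0 < c - a := by linarith
  have h1r : 0 < 1 - r := by linarith
  have hx : 0 < r * c - a := by linarith
  have h : Real.sqrt (1 + 4 * (c + 1) * r * (1 - r) / (a * (c - a))) < 1 + 2 * r / a := by
    rw [Real.sqrt_lt' (by positivity)]
    have : (1 + 2 * r / a) ^ 2 - (1 + 4 * (c + 1) * r * (1 - r) / (a * (c - a))) =
      4 * r * (1 + a) * (r * c - a) / (a ^ 2 * (c - a)) := by
      field_simp
      ring
    have : 0 < 4 * r * (1 + a) * (r * c - a) / (a ^ 2 * (c - a)) := by positivity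
    linarith
  have e : U a c r = (r * c - a) / (2 * r * (1 - r)) * (1 + (1 + 2 * r / a)) := by
    unfold U; field_simp; ring
  rw [e]; unfold B
  refine mul_lt_mul_of_pos_left (by linarith) (by positivity)

/-- For `c > a > 0` and `a/c < r < 1`, the solution `κ(r)` of `g(a, c; κ) = r`
satisfies `L(r) < κ(r) < B(r) < U(r)`. -/
theorem concentration_bounds_pos (a c r κr : ℝ) (ha : 0 < a) (hac : a < c)
    (hr1 : a / c < r) (hr2 : r < 1) (hκ : g a c κr = r) :
    L a c r < κr ∧ κr < B a c r ∧ B a c r < U a c r := by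
  have hc : 0 < c := by linarith
  have hr1' : a < r * c := (div_lt_iff₀ hc).1 hr1
  have hr0 : 0 < r := lt_trans (by positivity) hr1
  have hk : 0 < κr := by
    by_contra! hcon
    have := (g_facts a c ha hac κr).2.2.2.1 hcon
    rw [hκ] at this; linarith
  obtain ⟨hm, hcont, h0⟩ := barrier_g a c κr ha hac hk
  refine ⟨?_, ?_, B_lt_U a c r ha hac hr1' hr0 hr2⟩
  · have cL : ContinuousOn (L a c) (Set.Ioo 0 1) := by
      intro y hy
      have h1 : y ≠ 0 := hy.1.ne'
      have h2 : 1 - y ≠ 0 := by linarith [hy.2]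
      have h3 : y * (1 - y) ≠ 0 := mul_ne_zero h1 h2
      unfold L
      refine ContinuousAt.continuousWithinAt ?_
      fun_prop (disch := assumption)
    have := barrier (fun x => x - L a c (g a c x)) κr hk
      (continuousOn_id.sub (cL.comp hcont hm)) ?_ ?_
    · simp only [hκ] at this; linarith
    · have : L a c (a / c) = 0 := by unfold L; field_simp; simp
      simp only [h0, this]; simp
    · intro x hx _ hφ
      obtain ⟨g0, g1, gp, _, d, hd, hode⟩ := g_facts a c ha hac x
      obtain ⟨hL, e, he, he0, hlt⟩ := L_facts a c (g a c x) ha hac (gp hx) g0 g1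
      refine ⟨_, ?_, (hasDerivAt_id' x).sub (he.comp x hd)⟩
      have hde : d = g a c x * (1 - g a c x) - (g a c x * c - a) / x := by
        field_simp; linarith
      have : (g a c x * c - a) / L a c (g a c x) ≤ (g a c x * c - a) / x :=
        div_le_div_of_nonneg_left (by linarith [gp hx]) hx (by linarith)
      have : e * d ≤ e * (g a c x * (1 - g a c x) - (g a c x * c - a) / L a c (g a c x)) :=
        mul_le_mul_of_nonneg_left (by linarith) he0.le
      linarith
  · have cB : ContinuousOn (B a c) (Set.Ioo 0 1) := by
      intro y hy
      have h1 : y ≠ 0 := hy.1.ne'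
      have h2 : 1 - y ≠ 0 := by linarith [hy.2]
      have h3 : 2 * y * (1 - y) ≠ 0 := mul_ne_zero (by simpa using h1) h2
      unfold B
      refine ContinuousAt.continuousWithinAt ?_
      fun_prop (disch := assumption)
    have := barrier (fun x => B a c (g a c x) - x) κr hk
      ((cB.comp hcont hm).sub continuousOn_id) ?_ ?_
    · simp only [hκ] at this; linarith
    · have : B a c (a / c) = 0 := by
        unfold B
        have : a / c * c - a = 0 := by field_simp; simp
        rw [this]; simp
      simp only [h0, this]; simp
    · intro x hx _ hφ
      obtain ⟨g0, g1, gp, _, d, hd, hode⟩ := g_facts a c ha hac x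
      obtain ⟨hB, e, he, he0, hlt⟩ := B_facts a c (g a c x) ha hac (gp hx) g0 g1
      refine ⟨_, ?_, (he.comp x hd).sub (hasDerivAt_id' x)⟩
      have hde : d = g a c x * (1 - g a c x) - (g a c x * c - a) / x := by
        field_simp; linarith
      have : (g a c x * c - a) / x ≤ (g a c x * c - a) / B a c (g a c x) :=
        div_le_div_of_nonneg_left (by linarith [gp hx]) hB (by linarith)
      have : e * (g a c x * (1 - g a c x) - (g a c x * c - a) / B a c (g a c x)) ≤ e * d :=
        mul_le_mul_of_nonneg_left (by linarith) he0.le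
      linarith
end

section
/- Let c > a > 0 and 0 < r < a/c. If κ(r) is the solution of g(a,c;κ) = r, then L(r) < B(r) < κ(r) < U(r), with L, B, U as defined by L(r) = ((rc-a)/(r(1-r)))(1 + (1-r)/(c-a)), B(r) = ((rc-a)/(2r(1-r)))(1 + sqrt(1 + 4(c+1)r(1-r)/(a(c-a)))), U(r) = ((rc-a)/(r(1-r)))(1 + r/a). -/
/-- Coefficients. -/
noncomputable def coA (a c : ℝ) (j : ℕ) : ℝ := risingFac a j / risingFac c j

/-- The `n`-th derivative series of `M`. -/
noncomputable def Mn (a c : ℝ) (n : ℕ) (κ : ℝ) : ℝ :=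
  ∑' j : ℕ, coA a c (j + n) * κ ^ j / (Nat.factorial j : ℝ)

lemma rf_pos {a : ℝ} (ha : 0 < a) (j : ℕ) : 0 < risingFac a j := by
  induction j with
  | zero => simp [risingFac]
  | succ j ih => simp only [risingFac]; positivity

lemma rf_shift (a : ℝ) (j : ℕ) : risingFac a (j + 1) = a * risingFac (a + 1) j := by
  induction j with
  | zero => simp [risingFac]
  | succ j ih =>
    rw [risingFac, ih, risingFac]; push_cast; ring

lemma coA_pos {a c : ℝ} (ha : 0 < a) (hac : a < c) (j : ℕ) : 0 < coA a c j :=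
  div_pos (rf_pos ha j) (rf_pos (ha.trans hac) j)

lemma coA_succ {a c : ℝ} (ha : 0 < a) (hac : a < c) (j : ℕ) :
    coA a c (j + 1) * (c + j) = coA a c j * (a + j) := by
  have h1 := (rf_pos (ha.trans hac) j).ne'
  have h2 : (c + j) ≠ 0 := by have := ha.trans hac; positivity
  simp only [coA, risingFac]
  field_simp

lemma coA_shift {a c : ℝ} (j : ℕ) :
    coA a c (j + 1) = a / c * coA (a + 1) (c + 1) j := by
  simp only [coA, rf_shift]
  exact mul_div_mul_comm _ _ _ _

lemma coA_zero (a c : ℝ) : coA a c 0 = 1 := by simp [coA, risingFac]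

lemma coA_le_one {a c : ℝ} (ha : 0 < a) (hac : a < c) (j : ℕ) : coA a c j ≤ 1 := by
  induction j with
  | zero => simp [coA_zero]
  | succ j ih =>
    have h := coA_succ ha hac j
    have h0 := coA_pos ha hac j
    have h2 : 0 < (c + j) := by have := ha.trans hac; positivity
    by_contra hc
    push Not at hc
    nlinarith

lemma ser_summable (A : ℕ → ℝ) (hA : ∀ j, |A j| ≤ 1) (κ : ℝ) :
    Summable (fun j : ℕ => A j * κ ^ j / (Nat.factorial j : ℝ)) := by
  refine Summable.of_norm_bounded (Real.summable_pow_div_factorial |κ|) (fun j => ?_)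
  rw [Real.norm_eq_abs, abs_div, abs_mul, abs_pow, Nat.abs_cast]
  have := hA j
  gcongr
  exact mul_le_of_le_one_left (by positivity) this

lemma ser_term_shift (A : ℕ → ℝ) (κ : ℝ) (j : ℕ) :
    A (j + 1) * (((j + 1 : ℕ) : ℝ) * κ ^ (j + 1 - 1)) / (Nat.factorial (j + 1) : ℝ)
      = A (j + 1) * κ ^ j / (Nat.factorial j : ℝ) := by
  rw [Nat.factorial_succ]; push_cast
  have : (j : ℝ) + 1 ≠ 0 := by positivity
  have : (Nat.factorial j : ℝ) ≠ 0 := by positivity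
  field_simp

lemma ser_hasDerivAt (A : ℕ → ℝ) (hA : ∀ j, |A j| ≤ 1) (κ : ℝ) :
    HasDerivAt (fun x => ∑' j : ℕ, A j * x ^ j / (Nat.factorial j : ℝ))
      (∑' j : ℕ, A (j + 1) * κ ^ j / (Nat.factorial j : ℝ)) κ := by
  set R : ℝ := |κ| + 1 with hR
  have hRpos : 0 < R := by positivity
  have hu : Summable (fun j : ℕ => ((j : ℝ) * R ^ (j - 1)) / (Nat.factorial j : ℝ)) := by
    rw [← summable_nat_add_iff 1]
    refine (Real.summable_pow_div_factorial R).congr (fun j => ?_)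
    have := ser_term_shift (fun _ => 1) R j
    simpa using this.symm
  have hsub : κ ∈ Metric.ball (0 : ℝ) R := by
    rw [mem_ball_zero_iff, Real.norm_eq_abs]; linarith
  have key := hasDerivAt_tsum_of_isPreconnected (𝕜 := ℝ)
    (g := fun (j : ℕ) (x : ℝ) => A j * x ^ j / (Nat.factorial j : ℝ))
    (g' := fun (j : ℕ) (x : ℝ) => A j * ((j : ℝ) * x ^ (j - 1)) / (Nat.factorial j : ℝ))
    (t := Metric.ball (0 : ℝ) R) (y₀ := κ) (y := κ) hu
    Metric.isOpen_ball (convex_ball _ _).isPreconnected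
    (fun j x _ => ((hasDerivAt_pow j x).const_mul (A j)).div_const _)
    (fun j x hx => by
      rw [mem_ball_zero_iff, Real.norm_eq_abs] at hx
      rw [Real.norm_eq_abs, abs_div, abs_mul, abs_mul, abs_pow, Nat.abs_cast, Nat.abs_cast]
      have h1 := hA j
      have h2 : |x| ^ (j - 1) ≤ R ^ (j - 1) := pow_le_pow_left₀ (abs_nonneg x) hx.le _
      apply div_le_div_of_nonneg_right _ (by positivity)
      refine (mul_le_of_le_one_left (by positivity) h1).trans ?_
      exact mul_le_mul_of_nonneg_left h2 (by positivity))
    hsub (ser_summable A hA κ) hsub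
  refine key.congr_deriv ?_
  have hs : Summable (fun j : ℕ => A j * ((j : ℝ) * κ ^ (j - 1)) / (Nat.factorial j : ℝ)) := by
    rw [← summable_nat_add_iff 1]
    exact (ser_summable (fun j => A (j + 1)) (fun j => hA _) κ).congr
      (fun j => (ser_term_shift A κ j).symm)
  rw [hs.tsum_eq_zero_add]
  have h0 : ∀ j : ℕ, A (j + 1) * (((j + 1 : ℕ) : ℝ) * κ ^ (j + 1 - 1)) /
      (Nat.factorial (j + 1) : ℝ) = A (j + 1) * κ ^ j / (Nat.factorial j : ℝ) :=
    ser_term_shift A κ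
  rw [tsum_congr h0]
  simp

lemma coA_abs {a c : ℝ} (ha : 0 < a) (hac : a < c) (j : ℕ) : |coA a c j| ≤ 1 := by
  rw [abs_of_pos (coA_pos ha hac j)]; exact coA_le_one ha hac j

lemma Mn_hasDerivAt {a c : ℝ} (ha : 0 < a) (hac : a < c) (n : ℕ) (κ : ℝ) :
    HasDerivAt (Mn a c n) (Mn a c (n + 1) κ) κ := by
  have := ser_hasDerivAt (fun j => coA a c (j + n)) (fun j => coA_abs ha hac _) κ
  refine this.congr_deriv ?_
  simp only [Mn]
  refine tsum_congr (fun j => ?_)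
  rw [show j + (n + 1) = j + 1 + n by ring]

lemma Mn_shift (a c : ℝ) (n : ℕ) (κ : ℝ) :
    Mn a c (n + 1) κ = a / c * Mn (a + 1) (c + 1) n κ := by
  simp only [Mn]
  rw [← tsum_mul_left]
  refine tsum_congr (fun j => ?_)
  rw [← add_assoc, coA_shift]; ring

lemma Mn_at_zero (a c : ℝ) (n : ℕ) : Mn a c n 0 = coA a c n := by
  simp only [Mn]
  rw [tsum_eq_single 0]
  · simp
  · intro j hj; simp [hj]

/-- `κ` times the derivative series. -/
lemma ser_mul (A : ℕ → ℝ) (hA : ∀ j, |A j| ≤ 1) (κ : ℝ) :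
    HasSum (fun j : ℕ => (j : ℝ) * A j * κ ^ j / (Nat.factorial j : ℝ))
      (κ * ∑' j : ℕ, A (j + 1) * κ ^ j / (Nat.factorial j : ℝ)) := by
  have h := ((ser_summable (fun j => A (j + 1)) (fun j => hA _) κ).hasSum).mul_left κ
  rw [← hasSum_nat_add_iff' 1]
  simp only [Finset.sum_range_one, Nat.cast_zero, zero_mul, zero_div, sub_zero]
  refine (congrArg (fun f => HasSum f _) (funext fun j => ?_)).mpr h
  rw [Nat.factorial_succ]; push_cast
  have : (j : ℝ) + 1 ≠ 0 := by positivity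
  have : (Nat.factorial j : ℝ) ≠ 0 := by positivity
  field_simp
  ring

lemma Mn_ode {a c : ℝ} (ha : 0 < a) (hac : a < c) (κ : ℝ) :
    κ * Mn a c 2 κ = a * Mn a c 0 κ - (c - κ) * Mn a c 1 κ := by
  have hA := coA_abs ha hac
  have h1 := ser_mul (coA a c) hA κ
  have h2 := ser_mul (fun j => coA a c (j + 1)) (fun j => hA _) κ
  have h3 := (ser_summable (coA a c) hA κ).hasSum.mul_left a
  have h4 := (ser_summable (fun j => coA a c (j + 1)) (fun j => hA _) κ).hasSum.mul_left c
  have h5 := (h2.add h4).sub (h1.add h3)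
  have h6 := h5.unique (a₂ := 0) (by
    refine (congrArg (fun f => HasSum f _) (funext fun j => ?_)).mpr hasSum_zero
    have := coA_succ ha hac j
    have e : ((j : ℝ) * coA a c (j + 1) * κ ^ j / (Nat.factorial j : ℝ)
      + c * (coA a c (j + 1) * κ ^ j / (Nat.factorial j : ℝ))
      - ((j : ℝ) * coA a c j * κ ^ j / (Nat.factorial j : ℝ)
      + a * (coA a c j * κ ^ j / (Nat.factorial j : ℝ))))
      = (coA a c (j + 1) * (c + j) - coA a c j * (a + j)) * (κ ^ j / (Nat.factorial j : ℝ)) := by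
      ring
    rw [e, this]; simp)
  simp only [Mn]
  simp only [add_zero, add_assoc, Nat.reduceAdd] at h6 ⊢
  linarith

lemma Mn_ode' {a c : ℝ} (ha : 0 < a) (hac : a < c) (κ : ℝ) :
    κ * Mn a c 3 κ = (a + 1) * Mn a c 1 κ - (c + 1 - κ) * Mn a c 2 κ := by
  have h := Mn_ode (a := a + 1) (c := c + 1) (by linarith) (by linarith) κ
  rw [Mn_shift a c 2, Mn_shift a c 1, Mn_shift a c 0]
  linear_combination (a / c) * h

/-- Barrier lemma. -/
lemma barrier_s9 (f f' l : ℝ → ℝ) (hf : ∀ x, HasDerivAt f (f' x) x) (h0 : 0 ≤ f 0)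
    (hl : ∀ x < 0, 0 ≤ l x) (h : ∀ x < 0, 0 < x * f' x + l x * f x) :
    ∀ x < 0, 0 < f x := by
  intro x1 hx1
  by_contra hneg
  push Not at hneg
  have hcont : ContinuousOn f (Set.Icc x1 0) := fun x _ => (hf x).continuousAt.continuousWithinAt
  obtain ⟨y, hy, hmin⟩ := isCompact_Icc.exists_isMinOn (Set.nonempty_Icc.2 hx1.le) hcont
  have main : ∀ z, x1 ≤ z → z < 0 → (∀ x ∈ Set.Icc x1 0, f z ≤ f x) → f z ≤ 0 → False := by
    intro z hz1 hz0 hzm hfz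
    have hd : 0 ≤ f' z := by
      have ht := (hf z).tendsto_slope.mono_left
        (nhdsWithin_mono z (show Set.Ioi z ⊆ {z}ᶜ from fun x hx => ne_of_gt hx))
      refine ge_of_tendsto ht ?_
      filter_upwards [Ioo_mem_nhdsGT hz0] with x hx
      rw [slope_def_field]
      exact div_nonneg (sub_nonneg.2 (hzm x ⟨hz1.trans hx.1.le, hx.2.le⟩)) (sub_nonneg.2 hx.1.le)
    have := h z hz0
    have := hl z hz0
    nlinarith
  have hm : ∀ x ∈ Set.Icc x1 0, f y ≤ f x := fun x hx => hmin hx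
  have hy1 := hm x1 ⟨le_rfl, hx1.le⟩
  rcases lt_or_eq_of_le hy.2 with hlt | heq
  · exact main y hy.1 hlt hm (hy1.trans hneg)
  · rw [heq] at hm
    exact main x1 le_rfl hx1 (fun x hx => by linarith [hm x hx]) hneg

lemma Mn_pos {a c : ℝ} (ha : 0 < a) (hac : a < c) {κ : ℝ} (hκ : κ < 0) : 0 < Mn a c 0 κ := by
  have hc := ha.trans hac
  by_contra hneg
  push Not at hneg
  set h : ℝ → ℝ := fun x => Real.exp (-x) * Mn a c 0 x with hh
  set h1 : ℝ → ℝ := fun x => Real.exp (-x) * (Mn a c 1 x - Mn a c 0 x) with hh1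
  have he : ∀ x, HasDerivAt (fun x => Real.exp (-x)) (Real.exp (-x) * (-1)) x := fun x =>
    (hasDerivAt_neg x).exp
  have d0 : ∀ x, HasDerivAt h (h1 x) x := fun x => by
    refine ((he x).mul (Mn_hasDerivAt ha hac 0 x)).congr_deriv ?_
    simp only [hh1]; ring
  have d1 : ∀ x, HasDerivAt h1
      (Real.exp (-x) * (Mn a c 2 x - 2 * Mn a c 1 x + Mn a c 0 x)) x := fun x => by
    refine ((he x).mul ((Mn_hasDerivAt ha hac 1 x).sub (Mn_hasDerivAt ha hac 0 x))).congr_deriv ?_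
    simp only [Pi.sub_apply]; ring
  have hcont : ContinuousOn h (Set.Icc κ 0) := fun x _ => (d0 x).continuousAt.continuousWithinAt
  obtain ⟨y, hy, hmax⟩ := isCompact_Icc.exists_isMaxOn (Set.nonempty_Icc.2 hκ.le) hcont
  have hm : ∀ x ∈ Set.Icc κ 0, h x ≤ h y := fun x hx => hmax hx
  have hz : h 0 = 1 := by simp [hh, Mn_at_zero, coA_zero]
  have hy0 : 1 ≤ h y := by rw [← hz]; exact hm 0 ⟨hκ.le, le_rfl⟩
  have hk : h κ ≤ 0 := mul_nonpos_of_nonneg_of_nonpos (Real.exp_pos _).le hneg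
  have hyk : κ < y := lt_of_le_of_ne hy.1 (by rintro rfl; linarith)
  have hA1 : coA a c 1 = a / c := by simp [coA, risingFac]
  have hy2 : y < 0 := by
    refine lt_of_le_of_ne hy.2 ?_
    rintro rfl
    have hd : 0 ≤ h1 0 := by
      have ht := (d0 0).tendsto_slope.mono_left
        (nhdsWithin_mono 0 (show Set.Iio (0:ℝ) ⊆ {0}ᶜ from fun x hx => ne_of_lt hx))
      refine ge_of_tendsto ht ?_
      filter_upwards [Ioo_mem_nhdsLT hκ] with x hx
      rw [slope_def_field]
      exact div_nonneg_of_nonpos (sub_nonpos.2 (hm x ⟨hx.1.le, hx.2.le⟩)) (sub_nonpos.2 hx.2.le)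
    simp only [hh1, Mn_at_zero, hA1, coA_zero, neg_zero, Real.exp_zero, one_mul] at hd
    have : a / c < 1 := (div_lt_one hc).2 hac
    linarith
  have hlm : IsLocalMax h y := by
    filter_upwards [Icc_mem_nhds hyk hy2] with x hx using hm x hx
  have hder : h1 y = 0 := hlm.hasDerivAt_eq_zero (d0 y)
  have hderiv : deriv h = h1 := funext fun x => (d0 x).deriv
  have hep := Real.exp_pos (-y)
  have hm0 : 0 < Mn a c 0 y := by
    by_contra hq
    push Not at hq
    have : h y ≤ 0 := mul_nonpos_of_nonneg_of_nonpos hep.le hq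
    linarith
  have hm1 : Mn a c 1 y = Mn a c 0 y := by
    simp only [hh1] at hder
    rcases mul_eq_zero.1 hder with hz1 | hz1
    · exact absurd hz1 hep.ne'
    · linarith
  have hpos : 0 < Real.exp (-y) * (Mn a c 2 y - 2 * Mn a c 1 y + Mn a c 0 y) := by
    refine mul_pos hep ?_
    have ho := Mn_ode ha hac y
    rw [hm1] at ho ⊢
    by_contra hq
    push Not at hq
    have := mul_nonneg_of_nonpos_of_nonpos hy2.le hq
    nlinarith [mul_pos (sub_pos.2 hac) hm0]
  have hlmin : IsLocalMin h y := by
    refine isLocalMin_of_deriv_deriv_pos ?_ (by rw [hderiv]; exact hder) (d0 y).continuousAt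
    rw [hderiv, (d1 y).deriv]; exact hpos
  have hev : h =ᶠ[nhds y] fun _ => h y := by
    filter_upwards [hlm, hlmin] with x hx1 hx2 using le_antisymm hx1 hx2
  have hev1 : h1 =ᶠ[nhds y] fun _ => 0 := by
    have := hev.deriv
    rw [hderiv] at this
    simpa using this
  have := hev1.deriv_eq
  rw [(d1 y).deriv] at this
  rw [this] at hpos
  simp at hpos

lemma Mn1_pos {a c : ℝ} (ha : 0 < a) (hac : a < c) {κ : ℝ} (hκ : κ < 0) : 0 < Mn a c 1 κ := by
  rw [Mn_shift]
  have := ha.trans hac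
  exact mul_pos (by positivity) (Mn_pos (by linarith) (by linarith) hκ)

lemma coA_one (a c : ℝ) : coA a c 1 = a / c := by simp [coA, risingFac]

lemma coA_two (a c : ℝ) : coA a c 2 = a * (a + 1) / (c * (c + 1)) := by simp [coA, risingFac]

lemma D_pos {a c : ℝ} (ha : 0 < a) (hac : a < c) {κ : ℝ} (hκ : κ < 0) :
    0 < Mn a c 0 κ - Mn a c 1 κ := by
  have hc := ha.trans hac
  refine barrier_s9 (fun x => Mn a c 0 x - Mn a c 1 x) (fun x => Mn a c 1 x - Mn a c 2 x)
    (fun _ => a) (fun x => (Mn_hasDerivAt ha hac 0 x).sub (Mn_hasDerivAt ha hac 1 x)) ?_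
    (fun _ _ => ha.le) ?_ κ hκ
  · simp only [Mn_at_zero, coA_zero, coA_one]
    have : a / c < 1 := (div_lt_one hc).2 hac
    linarith
  · intro x hx
    have := Mn_ode ha hac x
    have := mul_pos (sub_pos.2 hac) (Mn1_pos ha hac hx)
    nlinarith

lemma N_pos {a c : ℝ} (ha : 0 < a) (hac : a < c) {κ : ℝ} (hκ : κ < 0) :
    0 < Mn a c 1 κ - Mn a c 2 κ := by
  have hc := ha.trans hac
  have := D_pos (a := a + 1) (c := c + 1) (by linarith) (by linarith) hκ
  rw [Mn_shift a c 1, Mn_shift a c 0, ← mul_sub]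
  exact mul_pos (by positivity) this

lemma W_hasDerivAt {a c : ℝ} (ha : 0 < a) (hac : a < c) (x : ℝ) :
    HasDerivAt (fun x => Mn a c 0 x * Mn a c 2 x - Mn a c 1 x ^ 2)
      (Mn a c 0 x * Mn a c 3 x - Mn a c 1 x * Mn a c 2 x) x := by
  refine (((Mn_hasDerivAt ha hac 0 x).mul (Mn_hasDerivAt ha hac 2 x)).sub
    ((Mn_hasDerivAt ha hac 1 x).pow 2)).congr_deriv ?_
  simp; ring

lemma W_zero {a c : ℝ} (ha : 0 < a) (hac : a < c) :
    Mn a c 0 0 * Mn a c 2 0 - Mn a c 1 0 ^ 2 = a * (c - a) / (c ^ 2 * (c + 1)) := by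
  have hc := ha.trans hac
  simp only [Mn_at_zero, coA_zero, coA_one, coA_two]
  field_simp; ring

lemma W_pos {a c : ℝ} (ha : 0 < a) (hac : a < c) {κ : ℝ} (hκ : κ < 0) :
    0 < Mn a c 0 κ * Mn a c 2 κ - Mn a c 1 κ ^ 2 := by
  have hc := ha.trans hac
  refine barrier_s9 (fun x => Mn a c 0 x * Mn a c 2 x - Mn a c 1 x ^ 2) _ (fun x => c - x)
    (W_hasDerivAt ha hac) ?_ (fun x hx => by linarith) ?_ κ hκ
  · rw [W_zero ha hac]
    have := sub_pos.2 hac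
    positivity
  · intro x hx
    have h1 := Mn_ode ha hac x
    have h2 := Mn_ode' ha hac x
    have h3 := mul_pos (Mn_pos ha hac hx) (N_pos ha hac hx)
    refine lt_of_lt_of_eq h3 ?_
    linear_combination (-Mn a c 0 x) * h2 + Mn a c 1 x * h1

lemma W1_pos {a c : ℝ} (ha : 0 < a) (hac : a < c) {κ : ℝ} (hκ : κ < 0) :
    0 < Mn a c 1 κ * Mn a c 3 κ - Mn a c 2 κ ^ 2 := by
  have hc := ha.trans hac
  have := W_pos (a := a + 1) (c := c + 1) (by linarith) (by linarith) hκ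
  rw [Mn_shift a c 2, Mn_shift a c 1, Mn_shift a c 0]
  have h2 : 0 < (a / c) ^ 2 := by positivity
  nlinarith [mul_pos h2 this]

lemma Delta_pos {a c : ℝ} (ha : 0 < a) (hac : a < c) {κ : ℝ} (hκ : κ < 0) :
    0 < (c + 1) / (a * (c - a)) * (Mn a c 1 κ - Mn a c 2 κ) ^ 2
      - (Mn a c 0 κ * Mn a c 2 κ - Mn a c 1 κ ^ 2) := by
  have hc := ha.trans hac
  have hb := sub_pos.2 hac
  set k := (c + 1) / (a * (c - a)) with hk
  have hkpos : 0 < k := by positivity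
  have hkab : k * (a * (c - a)) = c + 1 := by rw [hk]; field_simp
  refine barrier_s9 (fun κ => k * (Mn a c 1 κ - Mn a c 2 κ) ^ 2
      - (Mn a c 0 κ * Mn a c 2 κ - Mn a c 1 κ ^ 2))
    (fun x => k * (2 * (Mn a c 1 x - Mn a c 2 x) * (Mn a c 2 x - Mn a c 3 x))
      - (Mn a c 0 x * Mn a c 3 x - Mn a c 1 x * Mn a c 2 x))
    (fun x => c + c * k * ((Mn a c 1 x - Mn a c 2 x) / Mn a c 0 x) - x) ?_ ?_ ?_ ?_ κ hκ
  · intro x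
    refine HasDerivAt.sub ?_ (W_hasDerivAt ha hac x)
    refine ((((Mn_hasDerivAt ha hac 1 x).sub (Mn_hasDerivAt ha hac 2 x)).pow 2).const_mul
      k).congr_deriv ?_
    simp
  · rw [W_zero ha hac]
    simp only [Mn_at_zero, coA_one, coA_two]
    refine le_of_eq ?_
    rw [hk]; field_simp; ring
  · intro x hx
    have := N_pos ha hac hx
    have := Mn_pos ha hac hx
    have : 0 ≤ c * k * ((Mn a c 1 x - Mn a c 2 x) / Mn a c 0 x) := by positivity
    linarith
  · intro x hx
    have hN := N_pos ha hac hx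
    have hm := Mn_pos ha hac hx
    have h1 := Mn_ode ha hac x
    have h2 := Mn_ode' ha hac x
    generalize Mn a c 0 x = m0 at *
    generalize Mn a c 1 x = m1 at *
    generalize Mn a c 2 x = m2 at *
    generalize Mn a c 3 x = m3 at *
    have hP : 0 < (m1 - m2) / c * ((c * k * (m1 - m2) - m0) ^ 2 + k * (x * (m1 - m2)) ^ 2) := by
      have : 0 < k * (x * (m1 - m2)) ^ 2 := by
        have : x * (m1 - m2) ≠ 0 := mul_ne_zero hx.ne hN.ne'
        positivity
      have := sq_nonneg (c * k * (m1 - m2) - m0)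
      have : 0 < (c * k * (m1 - m2) - m0) ^ 2 + k * (x * (m1 - m2)) ^ 2 := by linarith
      positivity
    have key : m0 * (x * (k * (2 * (m1 - m2) * (m2 - m3)) - (m0 * m3 - m1 * m2))
        + (c + c * k * ((m1 - m2) / m0) - x) * (k * (m1 - m2) ^ 2 - (m0 * m2 - m1 ^ 2)))
        = (m1 - m2) / c * ((c * k * (m1 - m2) - m0) ^ 2 + k * (x * (m1 - m2)) ^ 2) := by
      have hX : x * (m1 - m2) = c * m1 - a * m0 := by linear_combination -h1
      have hc0 := hc.ne'
      have hm0 := hm.ne'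
      field_simp
      linear_combination (c * m0 * (-2 * k * (m1 - m2) - m0)) * h2
        + (-c * m0 * (m1 + k * (m1 - m2)) - k * (m1 - m2) * (x * (m1 - m2) + c * m1 - a * m0)) * hX
        + (m1 - m2) * m0 ^ 2 * hkab
    by_contra hq
    push Not at hq
    have := mul_nonpos_of_nonneg_of_nonpos hm.le hq
    linarith

/-- For `c > a > 0` and `0 < r < a/c`, the solution `κ(r)` of `g(a, c; κ) = r`
satisfies `L(r) < B(r) < κ(r) < U(r)`. -/
theorem concentration_bounds_neg (a c r κr : ℝ) (ha : 0 < a) (hac : a < c)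
    (hr1 : 0 < r) (hr2 : r < a / c) (hκ : g a c κr = r) :
    L a c r < B a c r ∧ B a c r < κr ∧ κr < U a c r := by
  have hc := ha.trans hac
  have hb := sub_pos.2 hac
  have hM : M a c = Mn a c 0 := by funext x; simp [M, Mn, coA]
  have hg : Mn a c 1 κr / Mn a c 0 κr = r := by
    rw [← hκ, g, hM, (Mn_hasDerivAt ha hac 0 κr).deriv]
  have hrc : r * c < a := (lt_div_iff₀ hc).1 hr2
  have hr3 : r < 1 := hr2.trans ((div_lt_one hc).2 hac)
  have hm0ne : Mn a c 0 κr ≠ 0 := by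
    intro h; rw [h, div_zero] at hg; linarith
  have h1 := Mn_ode ha hac κr
  have h2 := Mn_ode' ha hac κr
  have hκneg : κr < 0 := by
    by_contra hk0
    push Not at hk0
    have hm0 : 0 ≤ Mn a c 0 κr := tsum_nonneg (fun j => by
      have := coA_pos ha hac (j + 0)
      positivity)
    have hle : Mn a c 2 κr ≤ Mn a c 1 κr := by
      refine Summable.tsum_le_tsum (fun j => ?_)
        (ser_summable (fun j => coA a c (j + 2)) (fun j => coA_abs ha hac _) κr)
        (ser_summable (fun j => coA a c (j + 1)) (fun j => coA_abs ha hac _) κr)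
      have h := coA_succ ha hac (j + 1)
      have h3 := coA_pos ha hac (j + 1)
      have h4 : coA a c (j + 2) ≤ coA a c (j + 1) := by
        by_contra h5
        push Not at h5
        have h6 : 0 < c + ((j + 1 : ℕ) : ℝ) := by positivity
        have h7 : j + 1 + 1 = j + 2 := rfl
        rw [h7] at h
        nlinarith
      gcongr
    have hm0' : 0 < Mn a c 0 κr := lt_of_le_of_ne hm0 (Ne.symm hm0ne)
    rw [div_eq_iff hm0ne] at hg
    nlinarith [mul_nonneg hk0 (sub_nonneg.2 hle)]
  have hm := Mn_pos ha hac hκneg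
  have hN := N_pos ha hac hκneg
  have hW1 := W1_pos ha hac hκneg
  have hD := Delta_pos ha hac hκneg
  generalize Mn a c 0 κr = m0 at *
  generalize Mn a c 1 κr = m1 at *
  generalize Mn a c 2 κr = m2 at *
  generalize Mn a c 3 κr = m3 at *
  have hm1 : m1 = r * m0 := by rw [← hg]; field_simp
  have hr4 : 0 < 1 - r := by linarith
  obtain ⟨e, he⟩ : ∃ e, e = (m1 - m2) / m0 := ⟨_, rfl⟩
  have hepos : 0 < e := he ▸ div_pos hN hm
  have hm2 : m2 = (r - e) * m0 := by rw [he, hm1]; field_simp; ring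
  set k := (c + 1) / (a * (c - a)) with hk
  have hm02 : 0 < m0 ^ 2 := by positivity
  have hq : κr * e = r * c - a := by
    have : m0 * (κr * e - (r * c - a)) = 0 := by
      rw [hm2, hm1] at h1
      linear_combination -h1
    rcases mul_eq_zero.1 this with h | h
    · exact absurd h hm.ne'
    · linarith
  -- the two key inequalities
  have hv1 : r * (1 - r) - e < k * e ^ 2 := by
    rw [hm2, hm1] at hD
    have : 0 < m0 ^ 2 * (k * e ^ 2 - (r * (1 - r) - e)) := by
      refine lt_of_lt_of_eq hD ?_
      ring
    have := pos_of_mul_pos_right this hm02.le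
    linarith
  have hv2 : r * e < a * (r * (1 - r) - e) := by
    have h3 := mul_neg_of_neg_of_pos hκneg hW1
    have h4 : κr * (m1 * m3 - m2 ^ 2) = m0 ^ 2 * (r * e - a * (r * (1 - r) - e)) := by
      rw [hm2, hm1] at h2 ⊢
      linear_combination (r * m0) * h2 + (r - e) * m0 * m0 * hq
    rw [h4] at h3
    have := neg_of_mul_neg_right h3 hm02.le
    linarith
  have hp : 0 < r * (1 - r) := by positivity
  have hK0 : (r * c - a) / (r * (1 - r)) < 0 := div_neg_of_neg_of_pos (by linarith) hp
  set K0 := (r * c - a) / (r * (1 - r)) with hK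
  have hκK : κr = K0 * (r * (1 - r) / e) := by
    rw [hK, ← hq]; field_simp
  have hDk : 4 * (c + 1) * r * (1 - r) / (a * (c - a)) = 4 * (k * (r * (1 - r))) := by
    rw [hk]; ring
  have hB : B a c r = K0 * ((1 + Real.sqrt (1 + 4 * (k * (r * (1 - r))))) / 2) := by
    rw [B, hDk, hK]; field_simp
  have hL : L a c r = K0 * (1 + (1 - r) / (c - a)) := rfl
  have hU : U a c r = K0 * (1 + r / a) := rfl
  rw [hB, hL, hU]
  refine ⟨?_, ?_, ?_⟩
  · apply mul_lt_mul_of_neg_left _ hK0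
    have : Real.sqrt (1 + 4 * (k * (r * (1 - r)))) < 1 + 2 * ((1 - r) / (c - a)) := by
      rw [Real.sqrt_lt' (by positivity)]
      have h5 : (1 + 2 * ((1 - r) / (c - a))) ^ 2 - (1 + 4 * (k * (r * (1 - r))))
          = 4 * (1 - r) * (c - a + 1) * (a - r * c) / (a * (c - a) ^ 2) := by
        rw [hk]; field_simp; ring
      have : 0 < 4 * (1 - r) * (c - a + 1) * (a - r * c) / (a * (c - a) ^ 2) := by
        have : 0 < a - r * c := by linarith
        positivity
      linarith
    linarith
  · rw [hκK]
    apply mul_lt_mul_of_neg_left _ hK0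
    set y := r * (1 - r) / e with hy
    have : 2 * y - 1 < Real.sqrt (1 + 4 * (k * (r * (1 - r)))) := by
      apply Real.lt_sqrt_of_sq_lt
      have h6 : k * (r * (1 - r)) - (y ^ 2 - y)
          = r * (1 - r) * (k * e ^ 2 - (r * (1 - r) - e)) / e ^ 2 := by
        rw [hy]; field_simp
      have : 0 < r * (1 - r) * (k * e ^ 2 - (r * (1 - r) - e)) / e ^ 2 := by
        have : 0 < k * e ^ 2 - (r * (1 - r) - e) := by linarith
        positivity
      nlinarith
    linarith
  · rw [hκK]
    apply mul_lt_mul_of_neg_left _ hK0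
    rw [lt_div_iff₀ hepos]
    have : (1 + r / a) * e = (a * e + r * e) / a := by field_simp
    rw [this, div_lt_iff₀ ha]
    linarith
end
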